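/- Sum over mixing entails mixing of sums (sum-bigbmix): for any index set I and families (P_x)_{x∈I}, (Q_x)_{x∈I} of SL propositions, the entailment ⊕_{x∈I}(P_x + Q_x) ⊢ (⊕_{x∈I} P_x) + (⊕_{x∈I} Q_x) holds. -/

import Mathlib

open scoped Classical

noncomputable section

namespace QSL

/-! ## Resources -/

/-- Vectors over the Hilbert space with orthonormal basis indexed by `Q → {0,1}`. -/
def Vec {Qubit : Type} (Q : Finset Qubit) : Type := ({ q // q ∈ Q } → Bool) → ℂ

/-- A quantum state: a finite set of qubits together with a vector over them. -/
def QState (Qubit : Type) : Type := Σ Q : Finset Qubit, Vec Q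

/-- A store: a partial function from variables to values. -/
def Store (Var Val : Type) : Type := Var → Option Val

/-- A resource: a quantum state together with a store. -/
def Res (Qubit Var Val : Type) : Type := QState Qubit × Store Var Val

variable {Qubit Var Val : Type}

/-- Tensor product of vectors over disjoint qubit sets. -/
def tensorVec {Q Q' : Finset Qubit} (v : Vec Q) (w : Vec Q') : Vec (Q ∪ Q') := fun f =>
  v (fun q => f ⟨q.1, Finset.mem_union_left _ q.2⟩) *
  w (fun q => f ⟨q.1, Finset.mem_union_right _ q.2⟩)

/-- Transport of a vector along an equality of qubit sets. -/
def castVec {Q Q' : Finset Qubit} (h : Q = Q') (v : Vec Q) : Vec Q' := h ▸ v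

/-- The empty quantum state with scalar 1. -/
def unitQ : QState Qubit := ⟨(∅ : Finset Qubit), fun _ => 1⟩

/-- The unit resource: empty qubit set with scalar 1 and the empty store. -/
def unitRes : Res Qubit Var Val := (unitQ, fun _ => none)

/-- Partial product of resources: defined iff the qubit sets are disjoint and
the store domains are disjoint; takes the union of qubit sets, tensor product of
vectors, and union of stores. -/
def rmul (a b : Res Qubit Var Val) : Option (Res Qubit Var Val) :=
  if h : Disjoint a.1.1 b.1.1 ∧ ∀ x, a.2 x = none ∨ b.2 x = none then
    some (⟨a.1.1 ∪ b.1.1, tensorVec a.1.2 b.1.2⟩, fun x => a.2 x <|> b.2 x)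
  else none

/-- Partial sum of resources: defined iff the two resources have the same
qubit set and the same store; adds the vectors. -/
def radd (a b : Res Qubit Var Val) : Option (Res Qubit Var Val) :=
  if h : a.1.1 = b.1.1 ∧ a.2 = b.2 then
    some (⟨b.1.1, fun f => castVec h.1 a.1.2 f + b.1.2 f⟩, b.2)
  else none

/-- Incompatibility of resources: some variable lies in both store domains and
the stores disagree on it. -/
def incompat (a b : Res Qubit Var Val) : Prop :=
  ∃ x u u', a.2 x = some u ∧ b.2 x = some u' ∧ u ≠ u'

/-! ## Multisets (possibly infinite, as families up to bijective reindexing) -/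

/-- An indexed family representing a multiset. -/
structure PreMSet (A : Type) : Type 1 where
  idx : Type
  val : idx → A

/-- Equivalence of indexed families by bijective reindexing. -/
def msetEquiv {A : Type} (f g : PreMSet A) : Prop :=
  ∃ e : f.idx ≃ g.idx, ∀ i, f.val i = g.val (e i)

theorem msetEquiv_refl {A : Type} (f : PreMSet A) : msetEquiv f f :=
  ⟨Equiv.refl _, fun _ => rfl⟩

theorem msetEquiv_symm {A : Type} {f g : PreMSet A} : msetEquiv f g → msetEquiv g f
  | ⟨e, h⟩ => ⟨e.symm, fun i => by rw [h (e.symm i), Equiv.apply_symm_apply]⟩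

theorem msetEquiv_trans {A : Type} {f g k : PreMSet A} :
    msetEquiv f g → msetEquiv g k → msetEquiv f k
  | ⟨e, h⟩, ⟨e', h'⟩ => ⟨e.trans e', fun i => (h i).trans (h' (e i))⟩

instance msetSetoid (A : Type) : Setoid (PreMSet A) :=
  ⟨msetEquiv, ⟨msetEquiv_refl, msetEquiv_symm, msetEquiv_trans⟩⟩

/-- Multisets over `A`: families up to bijective reindexing. -/
def MSet (A : Type) : Type 1 := Quotient (msetSetoid A)

def MSet.mk {A : Type} (I : Type) (f : I → A) : MSet A :=
  Quotient.mk (msetSetoid A) ⟨I, f⟩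

/-- A canonical representative family of a multiset. -/
def MSet.out {A : Type} (m : MSet A) : PreMSet A := Quotient.out m

/-- `a` is an occurrence of the multiset `m`. -/
def MSet.MemM {A : Type} (a : A) (m : MSet A) : Prop := ∃ i, m.out.val i = a

def MSet.map {A B : Type} (f : A → B) (m : MSet A) : MSet B :=
  MSet.mk m.out.idx (fun i => f (m.out.val i))

/-- Sum (disjoint union) of two multisets. -/
def MSet.uplus {A : Type} (m m' : MSet A) : MSet A :=
  MSet.mk (m.out.idx ⊕ m'.out.idx) (Sum.elim m.out.val m'.out.val)

/-- Indexed sum (disjoint union) of a family of multisets. -/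
def MSet.biguplus {A : Type} (I : Type) (f : I → MSet A) : MSet A :=
  MSet.mk (Σ x : I, (f x).out.idx) (fun p => (f p.1).out.val p.2)


/-- Partial product of multisets of resources: an occurrence `a·b` for every
pair of occurrences, defined iff all these resource products are defined. -/
def mprodM (m m' : MSet (Res Qubit Var Val)) : Option (MSet (Res Qubit Var Val)) :=
  if h : ∀ (i : m.out.idx) (j : m'.out.idx), (rmul (m.out.val i) (m'.out.val j)).isSome then
    some (MSet.mk (m.out.idx × m'.out.idx)
      (fun p => (rmul (m.out.val p.1) (m'.out.val p.2)).get (h p.1 p.2)))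
  else none

/-- Sum of the two projections of a multiset of pairs of resources (the
multiset of pairs plays the role of a multiset bijection between its two
projections): defined iff all the componentwise resource sums are defined. -/
def msumr (r : MSet (Res Qubit Var Val × Res Qubit Var Val)) :
    Option (MSet (Res Qubit Var Val)) :=
  if h : ∀ i, (radd (r.out.val i).1 (r.out.val i).2).isSome then
    some (MSet.mk r.out.idx (fun i => (radd (r.out.val i).1 (r.out.val i).2).get (h i)))
  else none

/-! ## SL propositions -/

/-- An SL proposition: a set of multisets of resources. -/
abbrev SLProp (Qubit Var Val : Type) : Type 1 := Set (MSet (Res Qubit Var Val))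


/-- Entailment of SL propositions: set inclusion. -/
def entails (P Q : SLProp Qubit Var Val) : Prop := P ⊆ Q

/-- Separating conjunction. -/
def star (P Q : SLProp Qubit Var Val) : SLProp Qubit Var Val :=
  { m | ∃ mp ∈ P, ∃ mq ∈ Q, mprodM mp mq = some m }

/-- Sum of SL propositions: all defined sums `m +_r m'` over `m ∈ P`, `m' ∈ Q`
and multiset bijections `r` between `m` and `m'`. -/
def propSum (P Q : SLProp Qubit Var Val) : SLProp Qubit Var Val :=
  { m | ∃ r : MSet (Res Qubit Var Val × Res Qubit Var Val),
      MSet.map Prod.fst r ∈ P ∧ MSet.map Prod.snd r ∈ Q ∧ msumr r = some m }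

/-- Indexed bare mixing. -/
def bigMix (I : Type) (P : I → SLProp Qubit Var Val) : SLProp Qubit Var Val :=
  { m | ∃ f : I → MSet (Res Qubit Var Val), (∀ x, f x ∈ P x) ∧ m = MSet.biguplus I f }

/-- Binary bare mixing, the case of `bigMix` over a two-element index set. -/
def binMix (P Q : SLProp Qubit Var Val) : SLProp Qubit Var Val :=
  bigMix Bool (fun b => if b then Q else P)

/-- Precision: any two multisets in `P` are equal. -/
def precise (P : SLProp Qubit Var Val) : Prop := ∀ m ∈ P, ∀ m' ∈ P, m = m'

/-- Non-emptiness of behaviours: every multiset in `P` is nonempty. -/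
def nonnb (P : SLProp Qubit Var Val) : Prop := ∀ m ∈ P, Nonempty (MSet.out m).idx

/-- Unambiguity: any two occurrences at distinct indices are incompatible. -/
def unambig (P : SLProp Qubit Var Val) : Prop :=
  ∀ m ∈ P, ∀ i j : (MSet.out m).idx, i ≠ j → incompat (m.out.val i) (m.out.val j)

/-- Incompatibility of SL propositions: every occurrence of every `m ∈ P` is
incompatible with every occurrence of every `m' ∈ Q`. -/
def propIncompat (P Q : SLProp Qubit Var Val) : Prop :=
  ∀ m ∈ P, ∀ m' ∈ Q, ∀ (i : (MSet.out m).idx) (j : (MSet.out m').idx),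
    incompat (m.out.val i) (m'.out.val j)

/-- The singleton proposition of the one-element multiset of a resource. -/
def singletonProp (a : Res Qubit Var Val) : SLProp Qubit Var Val :=
  { m | m = MSet.mk PUnit (fun _ => a) }

/-- The points-to proposition `ι ↦ v`: empty quantum state (scalar 1) and the
store mapping only `ι` to `v`. -/
def varPoints (ι : Var) (v : Val) : SLProp Qubit Var Val :=
  singletonProp (unitQ, fun y => if y = ι then some v else none)

/-- Tagged mixing over an index set of values. -/
def taggedMix (ι : Var) (I : Set Val) (P : Val → SLProp Qubit Var Val) :
    SLProp Qubit Var Val :=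
  bigMix I (fun x => star (varPoints ι x.1) (P x.1))

theorem mk_eq {A J K : Type} {v : J → A} {w : K → A} (e : J ≃ K)
    (h : ∀ i, v i = w (e i)) : MSet.mk J v = MSet.mk K w :=
  Quotient.sound (s := msetSetoid A) ⟨e, h⟩

theorem out_mk {A J : Type} (v : J → A) :
    ∃ e : (MSet.mk J v).out.idx ≃ J, ∀ i, (MSet.mk J v).out.val i = v (e i) :=
  Quotient.mk_out (s := msetSetoid A) (⟨J, v⟩ : PreMSet A)

theorem map_mk {A B J : Type} (g : A → B) (v : J → A) :
    MSet.map g (MSet.mk J v) = MSet.mk J (fun j => g (v j)) := by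
  obtain ⟨e, he⟩ := out_mk v
  exact mk_eq e (fun i => by rw [he])

theorem biguplus_mk {A I : Type} (J : I → Type) (v : ∀ x, J x → A) :
    MSet.biguplus I (fun x => MSet.mk (J x) (v x))
      = MSet.mk (Σ x, J x) (fun p => v p.1 p.2) := by
  choose e he using fun x => out_mk (v x)
  exact mk_eq (Equiv.sigmaCongrRight e) (fun i => he i.1 i.2)

theorem msumr_mk {J : Type} (v : J → Res Qubit Var Val × Res Qubit Var Val)
    (w : J → Res Qubit Var Val) (h : ∀ j, radd (v j).1 (v j).2 = some (w j)) :
    msumr (MSet.mk J v) = some (MSet.mk J w) := by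
  obtain ⟨e, he⟩ := out_mk v
  have h' : ∀ i, radd ((MSet.mk J v).out.val i).1 ((MSet.mk J v).out.val i).2
      = some (w (e i)) := fun i => by rw [he, h]
  unfold msumr
  rw [dif_pos (fun i => by rw [h' i]; rfl)]
  exact congrArg some (mk_eq e (fun i => by simp [h' i]))

theorem msumr_some {r : MSet (Res Qubit Var Val × Res Qubit Var Val)}
    {m : MSet (Res Qubit Var Val)} (h : msumr r = some m) :
    ∃ w : r.out.idx → Res Qubit Var Val,
      (∀ i, radd (r.out.val i).1 (r.out.val i).2 = some (w i)) ∧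
      m = MSet.mk r.out.idx w := by
  unfold msumr at h
  split_ifs at h with h1
  exact ⟨_, fun i => (Option.some_get (h1 i)).symm, (Option.some.inj h).symm⟩

/-- Sum over mixing entails mixing of sums: `⊕ₓ(Pₓ + Qₓ) ⊢ (⊕ₓ Pₓ) + (⊕ₓ Qₓ)`. -/
theorem sum_bigbmix {Qubit Var Val : Type} (I : Type)
    (P Q : I → SLProp Qubit Var Val) :
    entails (bigMix I (fun x => propSum (P x) (Q x)))
      (propSum (bigMix I P) (bigMix I Q)) := by
  rintro m ⟨f, hf, rfl⟩
  choose r hP hQ hr using hf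
  choose w hw hfw using fun x => msumr_some (hr x)
  obtain rfl : f = fun x => MSet.mk (r x).out.idx (w x) := funext hfw
  refine ⟨MSet.biguplus I r, ⟨_, hP, ?_⟩, ⟨_, hQ, ?_⟩, ?_⟩
  · exact (map_mk _ _).trans (biguplus_mk (fun x => (r x).out.idx)
      (fun x i => ((r x).out.val i).1)).symm
  · exact (map_mk _ _).trans (biguplus_mk (fun x => (r x).out.idx)
      (fun x i => ((r x).out.val i).2)).symm
  · rw [biguplus_mk]
    exact msumr_mk _ _ (fun p => hw p.1 p.2)
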